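/- Let λ be an algebraic number of degree n with height H(λ), and let c = deg λ + log H(λ). If x = Σ_{k=1}^{n} z_k λ^{k-1} is a nonzero element of ℤ[λ] with z = (z_1,...,z_n) ∈ ℤ^n, then |x| · ‖z‖_∞^c ≥ e^{-c(n-1)}, where ‖z‖_∞ is the maximum absolute value of the coordinates. -/

import Mathlib

open Polynomial in
lemma aux_res_ne (P Q : ℤ[X]) (n : ℕ) (hn : 1 ≤ n) (hPirr : Irreducible P) (hPdeg : P.natDegree = n)
    (hQ : Q ≠ 0) (hQd : Q.natDegree ≤ n - 1) : resultant P Q n (n - 1) ≠ 0 := by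
  have hprim := hPirr.isPrimitive (by omega)
  have hirr := (IsPrimitive.Int.irreducible_iff_irreducible_map_cast hprim).1 hPirr
  have inj : Function.Injective (Int.castRingHom ℚ) := Int.cast_injective
  have hQ' : Q.map (Int.castRingHom ℚ) ≠ 0 := (Polynomial.map_ne_zero_iff inj).2 hQ
  have hcop : IsCoprime (P.map (Int.castRingHom ℚ)) (Q.map (Int.castRingHom ℚ)) := by
    rw [hirr.coprime_iff_not_dvd]
    intro hd
    have := natDegree_le_of_dvd hd hQ'
    rw [natDegree_map_eq_of_injective inj, natDegree_map_eq_of_injective inj] at this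
    omega
  have h1 := resultant_ne_zero _ _ hcop
  rw [natDegree_map_eq_of_injective inj, natDegree_map_eq_of_injective inj, resultant_map_map,
    hPdeg] at h1
  have h2 : resultant P Q n Q.natDegree ≠ 0 := fun h => h1 (by rw [h]; simp)
  obtain ⟨k, hk⟩ := Nat.exists_eq_add_of_le hQd
  rw [hk, resultant_add_right_deg _ _ _ _ _ le_rfl]
  refine mul_ne_zero (pow_ne_zero _ ?_) h2
  rw [← hPdeg]
  exact leadingCoeff_ne_zero.2 hPirr.ne_zero

open Polynomial in
lemma aux_main (p q : ℂ[X]) (n : ℕ) (hn : 1 ≤ n) (hp : p.natDegree = n) (l : ℂ) (hl : p.eval l = 0)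
    (B M : ℝ) (hB : 0 ≤ B) (hM : p.mahlerMeasure ≤ M) (hqd : q.natDegree ≤ n - 1)
    (hq : ∀ w, ‖q.eval w‖ ≤ B * max 1 ‖w‖ ^ (n - 1))
    (hres : 1 ≤ ‖resultant p q n (n - 1)‖) : 1 ≤ ‖q.eval l‖ * B ^ (n - 1) * M ^ (n - 1) := by
  have hp0 : p ≠ 0 := by rintro rfl; simp at hp; omega
  have hmem : l ∈ p.roots := by rw [mem_roots hp0]; exact hl
  obtain ⟨S, hS⟩ := Multiset.exists_cons_of_mem hmem
  have hcard : S.card = n - 1 := by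
    have := (IsAlgClosed.splits p).natDegree_eq_card_roots
    rw [hS, Multiset.card_cons] at this
    omega
  have h1 : ∀ T : Multiset ℂ, ‖(T.map q.eval).prod‖ ≤
      B ^ T.card * ((T.map (fun a ↦ max 1 ‖a‖)).prod) ^ (n - 1) := by
    intro T
    induction T using Multiset.induction_on with
    | empty => simp
    | cons a T ih =>
      simp only [Multiset.map_cons, Multiset.prod_cons, norm_mul, Multiset.card_cons]
      calc _ ≤ (B * max 1 ‖a‖ ^ (n - 1)) * (B ^ T.card * ((T.map (fun a ↦ max 1 ‖a‖)).prod) ^ (n - 1)) := by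
            gcongr
            exact hq a
        _ = _ := by rw [mul_pow]; ring
  have hSpos : 0 ≤ (S.map (fun a ↦ max 1 ‖a‖)).prod := by
    apply Multiset.prod_nonneg
    intro a ha
    obtain ⟨b, -, rfl⟩ := Multiset.mem_map.1 ha
    positivity
  have hM2 : ‖p.leadingCoeff‖ * (S.map (fun a ↦ max 1 ‖a‖)).prod ≤ M := by
    refine le_trans ?_ hM
    rw [mahlerMeasure_eq_leadingCoeff_mul_prod_roots, hS, Multiset.map_cons, Multiset.prod_cons]
    gcongr
    exact le_mul_of_one_le_left hSpos (le_max_left _ _)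
  have h2 := resultant_eq_prod_eval p q (n - 1) hqd (IsAlgClosed.splits p)
  rw [hp, hS, Multiset.map_cons, Multiset.prod_cons] at h2
  rw [h2, norm_mul, norm_mul, norm_pow] at hres
  refine hres.trans ?_
  have h3 := h1 S
  rw [hcard] at h3
  calc _ ≤ ‖p.leadingCoeff‖ ^ (n - 1) * (‖q.eval l‖ *
          (B ^ (n - 1) * ((S.map (fun a ↦ max 1 ‖a‖)).prod) ^ (n - 1))) := by gcongr
    _ = ‖q.eval l‖ * B ^ (n - 1) * (‖p.leadingCoeff‖ * (S.map (fun a ↦ max 1 ‖a‖)).prod) ^ (n - 1) := by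
        rw [mul_pow]; ring
    _ ≤ _ := by gcongr

lemma aux_exp (n : ℕ) (hn : 1 ≤ n) : (n : ℝ) * (n + 1) ≤ Real.exp n := by
  have he := Real.exp_one_gt_d9
  have key : ∀ k : ℕ, 2 ≤ k → (k : ℝ) * (k + 1) ≤ Real.exp k := by
    intro k hk
    induction k, hk using Nat.le_induction with
    | base =>
      have : Real.exp ((2 : ℕ) : ℝ) = Real.exp 1 * Real.exp 1 := by
        rw [← Real.exp_add]; norm_num
      rw [this]; push_cast; nlinarith
    | succ k hk ih =>
      push_cast
      rw [Real.exp_add]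
      have hk' : (2 : ℝ) ≤ k := by exact_mod_cast hk
      have := Real.exp_pos (k : ℝ)
      nlinarith
  rcases Nat.lt_or_ge n 2 with h | h
  · obtain rfl : n = 1 := by omega
    norm_num; linarith
  · exact key n h


/-- Liouville-type bound: if `x = Σ z_k λ^{k-1}` is a nonzero element of `ℤ[λ]`,
then `|x| · ‖z‖_∞^c ≥ e^{-c(n-1)}` where `c = deg λ + log H(λ)`. -/
theorem stmt0 (lam : ℝ) (n : ℕ) (hn : 1 ≤ n) (P : Polynomial ℤ)
    (hPirr : Irreducible P) (hPdeg : P.natDegree = n)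
    (hPmin : ∀ Q : Polynomial ℤ, Q ≠ 0 → Polynomial.aeval lam Q = 0 → P.natDegree ≤ Q.natDegree)
    (hroot : Polynomial.aeval lam P = 0)
    (H : ℝ) (hH : H = ((Finset.range (n + 1)).sup fun i => (P.coeff i).natAbs : ℕ))
    (c : ℝ) (hc : c = (n : ℝ) + Real.log H)
    (z : Fin n → ℤ) (x : ℝ) (hx : x = ∑ k : Fin n, (z k : ℝ) * lam ^ (k : ℕ))
    (hx0 : x ≠ 0) :
    |x| * ((Finset.univ.sup fun k => (z k).natAbs : ℕ) : ℝ) ^ c ≥ Real.exp (-(c * (n - 1))) := by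
  classical
  set Zn : ℕ := Finset.univ.sup fun k => (z k).natAbs with hZn
  set Hn : ℕ := (Finset.range (n + 1)).sup fun i => (P.coeff i).natAbs with hHn
  have hP0 := hPirr.ne_zero
  have hz : ∀ k, |(z k : ℝ)| ≤ Zn := by
    intro k
    have : (z k).natAbs ≤ Zn := Finset.le_sup (f := fun k => (z k).natAbs) (Finset.mem_univ k)
    rw [← Int.cast_abs, ← Nat.cast_natAbs]
    exact_mod_cast this
  have hcf : ∀ i ∈ Finset.range (n + 1), |(P.coeff i : ℝ)| ≤ Hn := by
    intro i hi
    have : (P.coeff i).natAbs ≤ Hn := Finset.le_sup (f := fun i => (P.coeff i).natAbs) hi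
    rw [← Int.cast_abs, ← Nat.cast_natAbs]
    exact_mod_cast this
  have hH1 : 1 ≤ H := by
    have h1 := hcf n (by simp)
    have h2 : P.coeff n ≠ 0 := by rw [← hPdeg]; exact Polynomial.leadingCoeff_ne_zero.2 hP0
    rw [hH]
    refine le_trans ?_ h1
    exact_mod_cast Int.one_le_abs h2
  have hZ1 : (1 : ℝ) ≤ Zn := by
    by_contra hlt
    have : Zn = 0 := by
      by_contra h
      exact hlt (by exact_mod_cast Nat.one_le_iff_ne_zero.2 h)
    apply hx0
    rw [hx]
    apply Finset.sum_eq_zero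
    intro k _
    have := hz k
    have h0 : (z k : ℝ) = 0 := by
      rw [‹Zn = 0›] at this
      simpa using this
    rw [h0, zero_mul]
  let Q : Polynomial ℤ := ∑ k : Fin n, Polynomial.C (z k) * Polynomial.X ^ (k : ℕ)
  have hQd : Q.natDegree ≤ n - 1 := by
    apply Polynomial.natDegree_sum_le_of_forall_le
    intro k _
    refine (Polynomial.natDegree_C_mul_X_pow_le _ _).trans ?_
    have := k.2
    omega
  have hQx : Polynomial.aeval lam Q = x := by
    rw [hx]; simp [Q]
  have hQ0 : Q ≠ 0 := by
    intro h
    rw [h] at hQx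
    exact hx0 (by simpa using hQx.symm)
  have hres := aux_res_ne P Q n hn hPirr hPdeg hQ0 hQd
  have inj : Function.Injective (Int.castRingHom ℂ) := Int.cast_injective
  have hQev : ∀ w : ℂ, (Q.map (Int.castRingHom ℂ)).eval w = ∑ k : Fin n, (z k : ℂ) * w ^ (k : ℕ) := by
    intro w
    simp [Q, Polynomial.eval_finsetSum, Polynomial.map_sum]
  have hQl : ‖(Q.map (Int.castRingHom ℂ)).eval (lam : ℂ)‖ = |x| := by
    rw [hQev, hx, ← Real.norm_eq_abs, ← Complex.norm_real]
    push_cast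
    rfl
  have main := aux_main (P.map (Int.castRingHom ℂ)) (Q.map (Int.castRingHom ℂ)) n hn
    (by rw [Polynomial.natDegree_map_eq_of_injective inj, hPdeg]) (lam : ℂ)
    (by
      have h : Polynomial.aeval (algebraMap ℝ ℂ lam) P = 0 := by
        rw [Polynomial.aeval_algebraMap_apply, hroot, map_zero]
      rw [Polynomial.eval_map]
      exact h)
    (n * Zn) ((n + 1) * H) (by positivity)
    (by
      refine (Polynomial.mahlerMeasure_le_sum_norm_coeff _).trans ?_
      rw [Polynomial.sum_over_range _ (by simp), Polynomial.natDegree_map_eq_of_injective inj, hPdeg]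
      calc _ ≤ ∑ i ∈ Finset.range (n + 1), H := by
            apply Finset.sum_le_sum
            intro i hi
            rw [Polynomial.coeff_map, hH]
            simpa using hcf i hi
        _ = _ := by simp)
    (by rw [Polynomial.natDegree_map_eq_of_injective inj]; exact hQd)
    (by
      intro w
      rw [hQev]
      refine (norm_sum_le _ _).trans ?_
      calc _ ≤ ∑ k : Fin n, (Zn : ℝ) * max 1 ‖w‖ ^ (n - 1) := by
            apply Finset.sum_le_sum
            intro k _
            rw [norm_mul, norm_pow]
            have h1 : ‖w‖ ^ (k : ℕ) ≤ max 1 ‖w‖ ^ (n - 1) := by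
              have := k.2
              exact (pow_le_pow_left₀ (norm_nonneg _) (le_max_right 1 _) _).trans
                (pow_le_pow_right₀ (le_max_left _ _) (by omega))
            have h2 : ‖(z k : ℂ)‖ ≤ Zn := by simpa using hz k
            gcongr
        _ = _ := by simp; ring)
    (by
      rw [Polynomial.resultant_map_map]
      have : (1 : ℝ) ≤ |((P.resultant Q n (n - 1) : ℤ) : ℝ)| := by
        exact_mod_cast Int.one_le_abs hres
      simpa using this)
  rw [hQl] at main
  have hH0 : 0 < H := by linarith
  have hZ0 : (0 : ℝ) < Zn := by linarith
  have hlog : 0 ≤ Real.log H := Real.log_nonneg hH1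
  have hcast : ((n - 1 : ℕ) : ℝ) = (n : ℝ) - 1 := by push_cast [hn]; ring
  have hZc : (Zn : ℝ) ^ (n - 1) ≤ (Zn : ℝ) ^ c := by
    rw [← Real.rpow_natCast]
    apply Real.rpow_le_rpow_of_exponent_le hZ1
    rw [hcast, hc]; linarith
  have hexp : Real.exp (c * (n - 1)) = (Real.exp n * H) ^ (n - 1) := by
    rw [← hcast, mul_comm, Real.exp_nat_mul, hc, Real.exp_add, Real.exp_log hH0]
  have hn1 := aux_exp n hn
  have hfin : 1 ≤ |x| * (Zn : ℝ) ^ c * Real.exp (c * (n - 1)) := by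
    refine main.trans ?_
    calc |x| * (n * Zn) ^ (n - 1) * ((n + 1) * H) ^ (n - 1)
        = |x| * (Zn : ℝ) ^ (n - 1) * ((n * (n + 1)) * H) ^ (n - 1) := by
          simp only [mul_pow]; ring
      _ ≤ |x| * (Zn : ℝ) ^ c * (Real.exp n * H) ^ (n - 1) := by gcongr
      _ = _ := by rw [hexp]
  rw [ge_iff_le, Real.exp_neg, inv_le_iff_one_le_mul₀ (Real.exp_pos _)]
  exact hfin
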